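/- For every finite n ≥ 4, the free group Γ of rank n contains subgroups A ≤ H with A a proper subgroup of H, such that acl(A) = H and dcl(A) = A. In particular, Γ contains a subgroup A whose definable closure dcl(A) is a proper subgroup of its algebraic closure acl(A). -/

import Mathlib

open FirstOrder Filter

/-! Common definitions: the first-order language of groups, algebraic/definable closures,
free products, amalgams, HNN extensions, etc. -/

/-- Function symbols of the language of groups: `1`, `⁻¹`, `·`. -/
inductive GrpFunc : ℕ → Type
  | one : GrpFunc 0
  | inv : GrpFunc 1
  | mul : GrpFunc 2

/-- The first-order language of groups `L = {·, ⁻¹, 1}` (no relation symbols). -/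
def grpLang : FirstOrder.Language := ⟨GrpFunc, fun _ => Empty⟩

/-- Every group is a `grpLang`-structure in the natural way. -/
instance grpStructure (G : Type*) [Group G] : grpLang.Structure G where
  funMap {_} f := match f with
    | .one => fun _ => (1 : G)
    | .inv => fun x => (x 0)⁻¹
    | .mul => fun x => x 0 * x 1
  RelMap {_} r := Empty.elim r

/-- A formula is existential if it is obtained from a quantifier-free formula by
prefixing existential quantifiers. -/
def IsExistential {L : FirstOrder.Language} {α : Type*} (φ : L.Formula α) : Prop :=
  ∃ (n : ℕ) (ψ : L.BoundedFormula α n), ψ.IsQF ∧ φ = ψ.exs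

section ModelTheory

variable (L : FirstOrder.Language) {M : Type*} [L.Structure M]

/-- The algebraic closure of a set of parameters `A` in an `L`-structure `M`:
elements satisfying, together with only finitely many other elements, some formula
with parameters from `A`. -/
def Lacl (A : Set M) : Set M :=
  {b | ∃ φ : L.Formula (↥A ⊕ Fin 1),
    {c : M | φ.Realize (Sum.elim Subtype.val fun _ => c)}.Finite ∧
    φ.Realize (Sum.elim Subtype.val fun _ => b)}

/-- The definable closure of a set of parameters `A` in an `L`-structure `M`. -/
def Ldcl (A : Set M) : Set M :=
  {b | ∃ φ : L.Formula (↥A ⊕ Fin 1),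
    {c : M | φ.Realize (Sum.elim Subtype.val fun _ => c)} = {b}}

/-- The existential algebraic closure of `A` in `M`. -/
def LaclE (A : Set M) : Set M :=
  {b | ∃ φ : L.Formula (↥A ⊕ Fin 1), IsExistential φ ∧
    {c : M | φ.Realize (Sum.elim Subtype.val fun _ => c)}.Finite ∧
    φ.Realize (Sum.elim Subtype.val fun _ => b)}

/-- The existential definable closure of `A` in `M`. -/
def LdclE (A : Set M) : Set M :=
  {b | ∃ φ : L.Formula (↥A ⊕ Fin 1), IsExistential φ ∧
    {c : M | φ.Realize (Sum.elim Subtype.val fun _ => c)} = {b}}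

end ModelTheory

section GroupDefs

variable {G : Type*} [Group G]

/-- Algebraic closure in a group, w.r.t. the language of groups. -/
def acl (A : Set G) : Set G := Lacl grpLang A

/-- Definable closure in a group, w.r.t. the language of groups. -/
def dcl (A : Set G) : Set G := Ldcl grpLang A

/-- Existential algebraic closure in a group. -/
def aclE (A : Set G) : Set G := LaclE grpLang A

/-- Existential definable closure in a group. -/
def dclE (A : Set G) : Set G := LdclE grpLang A

/-- Restricted algebraic closure: elements with finite orbit under automorphisms
of `G` fixing `A` pointwise. -/
def racl (A : Set G) : Set G :=
  {g | {x : G | ∃ f : G ≃* G, (∀ a ∈ A, f a = a) ∧ f g = x}.Finite}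

/-- Restricted definable closure: elements fixed by every automorphism of `G`
fixing `A` pointwise. -/
def rdcl (A : Set G) : Set G :=
  {g | ∀ f : G ≃* G, (∀ a ∈ A, f a = a) → f g = g}

/-- A set of group elements is nonabelian (contains two non-commuting elements). -/
def Nonabelian (A : Set G) : Prop := ∃ x ∈ A, ∃ y ∈ A, x * y ≠ y * x

/-- `F` is a free group of finite rank. -/
def IsFreeOfFiniteRank (F : Type*) [Group F] : Prop :=
  ∃ n : ℕ, Nonempty (F ≃* FreeGroup (Fin n))

/-- `G` is the internal free product of its subgroups `H` and `K`: the canonical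
homomorphism from the abstract free product `H ∗ K` to `G` is an isomorphism. -/
def InternalFreeProduct (H K : Subgroup G) : Prop :=
  Function.Bijective (Monoid.Coprod.lift H.subtype K.subtype)

/-- `G` is freely indecomposable relative to its subgroup `A`. -/
def FreelyIndecomposableRel (A : Subgroup G) : Prop :=
  ¬ ∃ G₁ G₂ : Subgroup G, G₁ ≠ ⊥ ∧ G₂ ≠ ⊥ ∧ A ≤ G₁ ∧ InternalFreeProduct G₁ G₂

/-- `B` is a free factor of the subgroup `K`: there is `L` such that the canonical
homomorphism from the abstract free product `B ∗ L` to the ambient group is injective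
with image exactly `K`. -/
def IsFreeFactorOf (B K : Subgroup G) : Prop :=
  ∃ L : Subgroup G,
    Function.Injective (Monoid.Coprod.lift B.subtype L.subtype) ∧
    (Monoid.Coprod.lift B.subtype L.subtype).range = K

/-- `K'` is the amalgamated free product `K ∗_C B` inside the ambient group `G`:
the canonical homomorphism from the abstract amalgamated product (pushout) of `K` and
`B` over `C` to `G` is injective with image exactly `K'`. -/
def IsAmalgamOf (K B C : Subgroup G) (hCK : C ≤ K) (hCB : C ≤ B) (K' : Subgroup G) : Prop :=
  ∃ ℓ : Monoid.PushoutI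
      (fun i : Bool =>
        (Subgroup.inclusion (show C ≤ cond i K B by cases i <;> assumption) :
          ↥C →* ↥(cond i K B))) →* G,
    (∀ i : Bool, ℓ.comp (Monoid.PushoutI.of i) = (cond i K B).subtype) ∧
    Function.Injective ℓ ∧ ℓ.range = K'

/-- `K'` is the HNN extension of `K` along `φ : C ≃* D` inside the ambient group `G`:
the canonical homomorphism from the abstract HNN extension of `K` along `φ` to `G` is
injective with image exactly `K'` (and is the inclusion on `K`). -/
def IsHNNOf (K : Subgroup G) {C D : Subgroup ↥K} (φ : ↥C ≃* ↥D) (K' : Subgroup G) : Prop :=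
  ∃ ℓ : HNNExtension ↥K C D φ →* G,
    ℓ.comp HNNExtension.of = K.subtype ∧ Function.Injective ℓ ∧ ℓ.range = K'

/-- One constructibility step: `K'` is an amalgamated free product of `K` with some
subgroup over a cyclic subgroup, or an HNN extension of `K` along an isomorphism of two
cyclic subgroups of `K`. -/
def ConstructStep (K K' : Subgroup G) : Prop :=
  (∃ (B C : Subgroup G) (hCK : C ≤ K) (hCB : C ≤ B),
      (∃ c : G, C = Subgroup.zpowers c) ∧ B ≤ K' ∧ K ≤ K' ∧ IsAmalgamOf K B C hCK hCB K')
  ∨ (∃ (C D : Subgroup ↥K) (φ : ↥C ≃* ↥D),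
      (∃ c : ↥K, C = Subgroup.zpowers c) ∧ (∃ d : ↥K, D = Subgroup.zpowers d) ∧ IsHNNOf K φ K')

/-- `B` is constructible from `A` by a finite sequence of amalgamated free products and
HNN-extensions along cyclic subgroups. -/
def ConstructibleFrom (A B : Subgroup G) : Prop := Relation.ReflTransGen ConstructStep A B

/-- The rank of a subgroup: the least cardinality of a generating set. For (subgroups of)
free groups this is the cardinality of a basis. -/
noncomputable def srank (H : Subgroup G) : Cardinal :=
  sInf {c : Cardinal | ∃ S : Set G, Subgroup.closure S = H ∧ c = Cardinal.mk ↥S}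

/-- `M` is a maximal abelian subgroup. -/
def IsMaxAbelian (M : Subgroup G) : Prop :=
  (∀ x ∈ M, ∀ y ∈ M, x * y = y * x) ∧
  ∀ N : Subgroup G, (∀ x ∈ N, ∀ y ∈ N, x * y = y * x) → M ≤ N → M = N

/-- `M` is a maximal abelian subgroup of the subgroup `H`. -/
def IsMaxAbelianIn (M H : Subgroup G) : Prop :=
  M ≤ H ∧ (∀ x ∈ M, ∀ y ∈ M, x * y = y * x) ∧
  ∀ N : Subgroup G, N ≤ H → (∀ x ∈ N, ∀ y ∈ N, x * y = y * x) → M ≤ N → M = N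

/-- `M` is a malnormal subgroup: `gMg⁻¹ ∩ M = 1` for every `g ∉ M`. -/
def Malnormal (M : Subgroup G) : Prop :=
  ∀ g : G, g ∉ M → ∀ x ∈ M, g * x * g⁻¹ ∈ M → x = 1

/-- A group is CSA if every maximal abelian subgroup is malnormal. -/
def IsCSA (G : Type*) [Group G] : Prop := ∀ M : Subgroup G, IsMaxAbelian M → Malnormal M

/-- Every abelian subgroup of `G` is cyclic. -/
def AbelianSubgroupsCyclic (G : Type*) [Group G] : Prop :=
  ∀ H : Subgroup G, (∀ x ∈ H, ∀ y ∈ H, x * y = y * x) → ∃ g : G, H = Subgroup.zpowers g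

/-- `G` is equationally noetherian: every system of equations over `G` in finitely many
variables is equivalent to a finite subsystem. -/
def EqNoetherian (G : Type*) [Group G] : Prop :=
  ∀ n : ℕ, 0 < n → ∀ S : Set (Monoid.Coprod G (FreeGroup (Fin n))),
    ∃ S₀ : Set (Monoid.Coprod G (FreeGroup (Fin n))), S₀ ⊆ S ∧ S₀.Finite ∧
      ∀ f : Monoid.Coprod G (FreeGroup (Fin n)) →* G,
        f.comp Monoid.Coprod.inl = MonoidHom.id G →
        ((∀ s ∈ S₀, f s = 1) ↔ ∀ s ∈ S, f s = 1)

/-- A group homomorphism is elementary w.r.t. the language of groups: it preserves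
and reflects all first-order formulas. -/
def ElementaryEmb {H K : Type*} [Group H] [Group K] (e : H →* K) : Prop :=
  ∀ (n : ℕ) (φ : grpLang.Formula (Fin n)) (v : Fin n → H),
    (φ.Realize fun i => e (v i)) ↔ φ.Realize v

/-- The inclusion of the subgroup `H` is an elementary embedding; i.e. the ambient group
is an elementary extension of `H`. -/
def ElementarySub (H : Subgroup G) : Prop := ElementaryEmb H.subtype

/-- A sequence of homomorphisms is stable. -/
def StableSeq {K H : Type*} [Group K] [Group H] (h : ℕ → (K →* H)) : Prop :=
  ∀ k : K, (∀ᶠ n in Filter.atTop, h n k = 1) ∨ (∀ᶠ n in Filter.atTop, h n k ≠ 1)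

/-- A sequence of homomorphisms has trivial stable kernel. -/
def TrivialStableKernel {K H : Type*} [Group K] [Group H] (h : ℕ → (K →* H)) : Prop :=
  ∀ k : K, (∀ᶠ n in Filter.atTop, h n k = 1) → k = 1

/-- A stable sequence of homomorphisms `g n : D → H` with trivial stable kernel strongly
converges to `D`, where `D` is a subgroup of an extension of the base group `H`, the base
group being embedded via `e`. -/
def StronglyConverges {H Gs : Type*} [Group H] [Group Gs] (e : H →* Gs)
    (D : Subgroup Gs) (g : ℕ → (↥D →* H)) : Prop :=
  StableSeq g ∧ TrivialStableKernel g ∧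
  (∀ (d : ↥D) (b : H), (d : Gs) = e b → ∀ᶠ n in Filter.atTop, g n d = b) ∧
  (∀ (d : ↥D) (b : H), (∃ᶠ n in Filter.atTop, g n d = b) → (d : Gs) = e b)

/-- The ball of radius `r` about the identity in the word metric w.r.t. `S`. -/
def wordBall (S : Set G) (r : ℕ) : Set G :=
  {g | ∃ l : List G, l.length ≤ r ∧ (∀ x ∈ l, x ∈ S ∨ x⁻¹ ∈ S) ∧ l.prod = g}

end GroupDefs

section Closures

open FirstOrder.Language

/-- The product of two terms in the language of groups. -/
def mulTerm {β : Type*} (s t : grpLang.Term β) : grpLang.Term β :=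
  Functions.apply₂ (L := grpLang) GrpFunc.mul s t

/-- The inverse of a term in the language of groups. -/
def invTerm {β : Type*} (s : grpLang.Term β) : grpLang.Term β :=
  Functions.apply₁ (L := grpLang) GrpFunc.inv s

theorem realize_mulTerm {G : Type*} [Group G] {β : Type*} (s t : grpLang.Term β) (v : β → G) :
    (mulTerm s t).realize v = s.realize v * t.realize v :=
  Term.realize_functions_apply₂.trans rfl

theorem realize_invTerm {G : Type*} [Group G] {β : Type*} (s : grpLang.Term β) (v : β → G) :
    (invTerm s).realize v = (s.realize v)⁻¹ :=
  Term.realize_functions_apply₁.trans rfl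

variable {G : Type*} [Group G]

theorem subset_dcl (A : Set G) : A ⊆ dcl A := by
  intro a ha
  refine ⟨Term.equal (Term.var (Sum.inr 0)) (Term.var (Sum.inl ⟨a, ha⟩)), ?_⟩
  ext c
  simp [Formula.realize_equal]

theorem dcl_subset_acl (A : Set G) : dcl A ⊆ acl A := by
  rintro b ⟨φ, hφ⟩
  refine ⟨φ, hφ ▸ Set.finite_singleton b, ?_⟩
  have : b ∈ {c : G | φ.Realize (Sum.elim Subtype.val fun _ => c)} := hφ ▸ rfl
  exact this

theorem mul_inv_mem_acl (A : Set G) {b c : G} (hb : b ∈ acl A) (hc : c ∈ acl A) :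
    b * c⁻¹ ∈ acl A := by
  obtain ⟨φ, hφ, hφb⟩ := hb
  obtain ⟨ψ, hψ, hψc⟩ := hc
  let g (j : Fin 2) : ↥A ⊕ Fin 1 → (↥A ⊕ Fin 1) ⊕ Fin 2 :=
    Sum.elim (fun a => Sum.inl (Sum.inl a)) fun _ => Sum.inr j
  let θ : grpLang.Formula ((↥A ⊕ Fin 1) ⊕ Fin 2) :=
    (φ.relabel (g 0) ⊓ ψ.relabel (g 1)) ⊓
      Term.equal (Term.var (Sum.inl (Sum.inr 0)))
        (mulTerm (Term.var (Sum.inr 0)) (invTerm (Term.var (Sum.inr 1))))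
  have hg (x : G) (i : Fin 2 → G) (j : Fin 2) :
      Sum.elim (Sum.elim Subtype.val fun _ => x) i ∘ g j =
        (Sum.elim Subtype.val fun _ => i j : ↥A ⊕ Fin 1 → G) := by
    ext (a | k) <;> rfl
  have key (x : G) : (θ.iExs (Fin 2)).Realize (Sum.elim Subtype.val fun _ => x) ↔
      ∃ i : Fin 2 → G, (φ.Realize (Sum.elim Subtype.val fun _ => i 0) ∧
        ψ.Realize (Sum.elim Subtype.val fun _ => i 1)) ∧ x = i 0 * (i 1)⁻¹ := by
    rw [Formula.realize_iExs]
    simp only [θ, Formula.realize_inf, Formula.realize_relabel, hg, Formula.realize_equal,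
      realize_mulTerm, realize_invTerm, Term.realize_var, Sum.elim_inl, Sum.elim_inr]
  refine ⟨θ.iExs (Fin 2), ?_, (key _).2 ⟨![b, c], ⟨hφb, hψc⟩, rfl⟩⟩
  refine (Set.Finite.image2 (fun b c => b * c⁻¹) hφ hψ).subset fun x hx => ?_
  obtain ⟨i, ⟨h0, h1⟩, rfl⟩ := (key x).1 hx
  exact ⟨i 0, h0, i 1, h1, rfl⟩

/-- The algebraic closure of a subgroup, as a subgroup. -/
def aclSubgroup (A : Subgroup G) : Subgroup G :=
  Subgroup.ofDiv (acl (A : Set G)) ⟨1, dcl_subset_acl _ (subset_dcl _ A.one_mem)⟩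
    fun _ hx _ hy => mul_inv_mem_acl _ hx hy

/-- A group automorphism, as an automorphism of the structure in the language of groups. -/
def grpLangEquiv (f : G ≃* G) : grpLang.Equiv G G where
  toEquiv := f.toEquiv
  map_fun' := by
    rintro _ (_ | _ | _) x
    · exact map_one f
    · exact map_inv f _
    · exact map_mul f _ _
  map_rel' := by
    rintro _ r
    exact r.elim

theorem dcl_subset_rdcl (A : Set G) : dcl A ⊆ rdcl A := by
  rintro b ⟨φ, hφ⟩ f hf
  have hb : b ∈ {c : G | φ.Realize (Sum.elim Subtype.val fun _ => c)} := hφ ▸ rfl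
  have hfb : f b ∈ {c : G | φ.Realize (Sum.elim Subtype.val fun _ => c)} := by
    have h := (StrongHomClass.realize_formula (grpLangEquiv f) φ).2 hb
    have hv : (grpLangEquiv f) ∘ (Sum.elim Subtype.val fun _ => b : ↥A ⊕ Fin 1 → G) =
        Sum.elim Subtype.val fun _ => f b := by
      ext (a | k)
      · exact hf a a.2
      · rfl
    rwa [hv] at h
  rw [hφ] at hfb
  exact hfb

theorem dcl_fixedPoints (f : G ≃* G) :
    dcl ((f.toMonoidHom.eqLocus (MonoidHom.id G) : Subgroup G) : Set G) =
      (f.toMonoidHom.eqLocus (MonoidHom.id G) : Subgroup G) :=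
  Set.Subset.antisymm (fun _ hb => dcl_subset_rdcl _ hb f fun _ ha => ha) (subset_dcl _)

end Closures

section TwistWord

variable {G : Type*} [Group G]

/-- The word `a x b x⁻¹ a x`. -/
def halfTwist (a b x : G) : G := a * x * b * x⁻¹ * a * x

/-- The word `a x b x⁻¹ a x · a x⁻¹ b x a x⁻¹`, whose conjugacy class is invariant under
`x ↦ x⁻¹`. -/
def twist (a b x : G) : G := halfTwist a b x * halfTwist a b x⁻¹

theorem map_halfTwist {K : Type*} [Group K] (f : G →* K) (a b x : G) :
    f (halfTwist a b x) = halfTwist (f a) (f b) (f x) := by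
  simp [halfTwist]

theorem map_twist {K : Type*} [Group K] (f : G →* K) (a b x : G) :
    f (twist a b x) = twist (f a) (f b) (f x) := by
  simp [twist, map_halfTwist]

/-- If finitely many `x` satisfy `twist a b x ∼ c`, then each such `x` is algebraic over any set
containing `a`, `b` and `c`. -/
theorem mem_acl_of_finite_twist {A : Set G} {a b c : G} (ha : a ∈ A) (hb : b ∈ A) (hc : c ∈ A)
    (hfin : {x : G | ∃ q, twist a b x = q * c * q⁻¹}.Finite) {y q : G}
    (hy : twist a b y = q * c * q⁻¹) : y ∈ acl A := by
  let V := (↥A ⊕ Fin 1) ⊕ Fin 1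
  let v : V → grpLang.Term V := FirstOrder.Language.Term.var
  let ta := v (Sum.inl (Sum.inl ⟨a, ha⟩))
  let tb := v (Sum.inl (Sum.inl ⟨b, hb⟩))
  let tc := v (Sum.inl (Sum.inl ⟨c, hc⟩))
  let tx := v (Sum.inl (Sum.inr 0))
  let tq := v (Sum.inr 0)
  let half (x : grpLang.Term V) : grpLang.Term V := 
    mulTerm (mulTerm (mulTerm (mulTerm (mulTerm ta x) tb) (invTerm x)) ta) x
  let θ : grpLang.Formula V :=
    FirstOrder.Language.Term.equal (mulTerm (half tx) (half (invTerm tx)))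
      (mulTerm (mulTerm tq tc) (invTerm tq))
  have key (x : G) : (θ.iExs (Fin 1)).Realize (Sum.elim Subtype.val fun _ => x) ↔
      ∃ q, twist a b x = q * c * q⁻¹ := by
    rw [FirstOrder.Language.Formula.realize_iExs]
    simp only [θ, half, ta, tb, tc, tx, tq, v, FirstOrder.Language.Formula.realize_equal,
      realize_mulTerm, realize_invTerm, FirstOrder.Language.Term.realize_var, Sum.elim_inl,
      Sum.elim_inr, twist, halfTwist]
    exact ⟨fun ⟨i, h⟩ => ⟨i 0, h⟩, fun ⟨q, h⟩ => ⟨fun _ => q, h⟩⟩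
  exact ⟨θ.iExs (Fin 1), by simpa only [key] using hfin, (key y).2 ⟨q, hy⟩⟩

end TwistWord

theorem List.exists_maximal_prefix_suffix {β : Type*} (p : β → Prop) (l : List β) :
    (∀ x ∈ l, p x) ∨ ∃ g z h, l = g ++ z ++ h ∧ (∀ x ∈ g, p x) ∧ (∀ x ∈ h, p x) ∧ z ≠ [] ∧
      (∀ x ∈ z.head?, ¬ p x) ∧ ∀ x ∈ z.getLast?, ¬ p x := by
  induction l with
  | nil => simp
  | cons b l ih =>
    by_cases hb : p b
    · rcases ih with h | ⟨g, z, h, rfl, hg, hh, hz⟩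
      · exact Or.inl (by simpa using ⟨hb, h⟩)
      · exact Or.inr ⟨b :: g, z, h, by simp, by simpa using ⟨hb, hg⟩, hh, hz⟩
    · rcases ih with h | ⟨g, z, h, rfl, hg, hh, hz, -, hlast⟩
      · exact Or.inr ⟨[], [b], l, by simp, by simp, h, by simp, by simpa, by simpa⟩
      · refine Or.inr ⟨[], b :: (g ++ z), h, by simp, by simp, hh, by simp, by simpa, ?_⟩
        rwa [← List.cons_append, List.getLast?_append_of_ne_nil _ hz]

namespace FreeGroup

variable {α : Type*}

theorem IsCyclicallyReduced.length_le_norm_of_mk_eq_conj [DecidableEq α] {L : List (α × Bool)}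
    (hL : IsCyclicallyReduced L) {q w : FreeGroup α} (h : mk L = q * w * q⁻¹) :
    L.length ≤ norm w := by
  have key (n : ℕ) : n * L.length ≤ norm q + n * norm w + norm q := by
    have h1 : norm (mk L ^ n) = n * L.length := by
      rw [norm, toWord_pow, toWord_mk, hL.isReduced.reduce_eq,
        (hL.flatten_replicate n).isReduced.reduce_eq]
      simp
    have h2 : norm (w ^ n) ≤ n * norm w := by
      induction n with
      | zero => simp
      | succ n ih =>
        rw [pow_succ, add_mul, one_mul]
        exact (norm_mul_le _ _).trans (Nat.add_le_add_right (ih (by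
          rw [norm, toWord_pow, toWord_mk, hL.isReduced.reduce_eq,
            (hL.flatten_replicate n).isReduced.reduce_eq]
          simp)) _)
    rw [← h1, h, conj_pow]
    calc norm (q * w ^ n * q⁻¹) ≤ norm (q * w ^ n) + norm q⁻¹ := norm_mul_le _ _
      _ ≤ norm q + norm (w ^ n) + norm q := by
        rw [norm_inv_eq]
        exact Nat.add_le_add_right (norm_mul_le _ _) _
      _ ≤ _ := by omega
  by_contra! hlt
  have h3 := key (2 * norm q + 1)
  nlinarith

theorem IsReduced.invRev {L : List (α × Bool)} (h : IsReduced L) :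
    IsReduced (invRev L) := by
  classical
  rw [isReduced_iff_reduce_eq, reduce_invRev, h.reduce_eq]

/-- If conjugating `of i` by a nonempty reduced word gives a letter, the word starts with a power
of `of i`. -/
theorem fst_eq_of_norm_conj_le_one [DecidableEq α] {l : α × Bool} {g : List (α × Bool)}
    (hg : IsReduced (l :: g)) {i : α}
    (h : norm ((mk (l :: g))⁻¹ * of i * mk (l :: g)) ≤ 1) : l.1 = i := by
  by_contra hne
  have hred : IsReduced (invRev (l :: g) ++ ([(i, true)] ++ (l :: g))) := by
    refine List.isChain_append.2 ⟨hg.invRev, ?_, ?_⟩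
    · refine List.isChain_cons_cons.2 ⟨fun h' => absurd h'.symm hne, hg⟩
    · simp [invRev, hne]
  have heq : (mk (l :: g))⁻¹ * of i * mk (l :: g) =
      mk (invRev (l :: g) ++ ([(i, true)] ++ (l :: g))) := by
    rw [← mul_mk, ← mul_mk, ← inv_mk, mul_assoc]
    rfl
  rw [heq, norm, toWord_mk, hred.reduce_eq] at h
  simp only [List.length_append, List.length_cons] at h
  omega

theorem eq_nil_of_norm_conj_le_one [DecidableEq α] {g : List (α × Bool)} (hg : IsReduced g)
    {i j : α} (hij : i ≠ j) (hi : norm ((mk g)⁻¹ * of i * mk g) ≤ 1)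
    (hj : norm ((mk g)⁻¹ * of j * mk g) ≤ 1) : g = [] := by
  cases g with
  | nil => rfl
  | cons l g =>
    exact absurd ((fst_eq_of_norm_conj_le_one hg hi).symm.trans (fst_eq_of_norm_conj_le_one hg hj))
      hij

theorem forall_mem_toWord_mul [DecidableEq α] {p : α → Prop} {x y : FreeGroup α}
    (hx : ∀ l ∈ x.toWord, p l.1) (hy : ∀ l ∈ y.toWord, p l.1) : ∀ l ∈ (x * y).toWord, p l.1 := by
  intro l hl
  rcases List.mem_append.1 ((toWord_mul_sublist x y).subset hl) with h | h
  exacts [hx l h, hy l h]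

theorem forall_mem_invRev {p : α → Prop} {L : List (α × Bool)} (hL : ∀ l ∈ L, p l.1) :
    ∀ l ∈ invRev L, p l.1 := by
  intro l hl
  simp only [invRev, List.mem_reverse, List.mem_map] at hl
  obtain ⟨k, hk, rfl⟩ := hl
  exact hL k hk

theorem forall_mem_toWord_inv [DecidableEq α] {p : α → Prop} {x : FreeGroup α}
    (hx : ∀ l ∈ x.toWord, p l.1) : ∀ l ∈ (x⁻¹).toWord, p l.1 := by
  rw [toWord_inv]
  exact forall_mem_invRev hx

theorem lift_ite_eq_self {p : α → Prop} [DecidablePred p] {L : List (α × Bool)}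
    (hL : ∀ l ∈ L, p l.1) :
    FreeGroup.lift (fun i => if p i then of i else 1) (mk L) = mk L := by
  induction L with
  | nil => exact _root_.map_one _
  | cons l L ih =>
    have h : mk (l :: L) = mk [l] * mk L := by rw [mul_mk]; rfl
    rw [h, _root_.map_mul, ih fun k hk => hL k (List.mem_cons_of_mem _ hk)]
    congr 1
    have hl : p l.1 := hL l List.mem_cons_self
    obtain ⟨i, _ | _⟩ := l <;> simp_all [of, inv_mk, invRev]

/-- Alternating products of nontrivial words in the letters satisfying `p` and of a word and its
inverse beginning and ending with other letters are cyclically reduced. -/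
theorem isCyclicallyReduced_flatten_alternating {p : α → Prop} {z : List (α × Bool)}
    (hz : IsReduced z) (hz0 : z ≠ []) (hhead : ∀ x ∈ z.head?, ¬ p x.1)
    (hlast : ∀ x ∈ z.getLast?, ¬ p x.1) {P₁ P₂ P₃ R₁ R₂ R₃ : List (α × Bool)}
    (h : ∀ L ∈ [P₁, P₂, P₃, R₁, R₂, R₃], IsReduced L ∧ L ≠ [] ∧ ∀ x ∈ L, p x.1) :
    IsCyclicallyReduced [P₁, z, R₁, invRev z, P₂, z, R₂, invRev z, P₃, z, R₃, invRev z].flatten := by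
  have hz' : invRev z ≠ [] := by simpa [invRev] using hz0
  have hhead' : ∀ x ∈ (invRev z).head?, ¬ p x.1 := by
    rw [invRev, List.head?_reverse]
    simp only [List.getLast?_map, Option.mem_def, Option.map_eq_some_iff]
    rintro _ ⟨x, hx, rfl⟩
    exact hlast x hx
  have hlast' : ∀ x ∈ (invRev z).getLast?, ¬ p x.1 := by
    rw [invRev, List.getLast?_reverse]
    simp only [List.head?_map, Option.mem_def, Option.map_eq_some_iff]
    rintro _ ⟨x, hx, rfl⟩
    exact hhead x hx
  have hzr := hz.invRev
  have hPz {P Q : List (α × Bool)} (hP : ∀ x ∈ P, p x.1) (hQ : ∀ x ∈ Q.head?, ¬ p x.1) :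
      ∀ x ∈ P.getLast?, ∀ y ∈ Q.head?, x.1 = y.1 → x.2 = y.2 := fun x hx y hy hxy =>
    absurd (hxy ▸ hP x (List.mem_of_getLast? hx)) (hQ y hy)
  have hzP {P Q : List (α × Bool)} (hP : ∀ x ∈ P, p x.1) (hQ : ∀ x ∈ Q.getLast?, ¬ p x.1) :
      ∀ x ∈ Q.getLast?, ∀ y ∈ P.head?, x.1 = y.1 → x.2 = y.2 := fun x hx y hy hxy =>
    absurd (hxy.symm ▸ hP y (List.mem_of_head? hy)) (hQ x hx)
  simp only [List.forall_mem_cons, List.not_mem_nil, false_imp_iff, implies_true, and_true] at h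
  obtain ⟨⟨p1, p1', p1''⟩, ⟨p2, p2', p2''⟩, ⟨p3, p3', p3''⟩, ⟨r1, r1', r1''⟩, ⟨r2, r2', r2''⟩,
    ⟨r3, r3', r3''⟩⟩ := h
  constructor
  · refine (List.isChain_flatten ?_).2 ⟨?_, ?_⟩
    · simp only [List.mem_cons, List.not_mem_nil, or_false, not_or]
      exact ⟨p1'.symm, hz0.symm, r1'.symm, hz'.symm, p2'.symm, hz0.symm, r2'.symm, hz'.symm,
        p3'.symm, hz0.symm, r3'.symm, hz'.symm⟩
    · simp only [List.forall_mem_cons, List.not_mem_nil, false_imp_iff, implies_true, and_true]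
      exact ⟨p1, hz, r1, hzr, p2, hz, r2, hzr, p3, hz, r3, hzr⟩
    · simp only [List.isChain_cons_cons, List.isChain_singleton, and_true]
      exact ⟨hPz p1'' hhead, hzP r1'' hlast, hPz r1'' hhead', hzP p2'' hlast', hPz p2'' hhead,
        hzP r2'' hlast, hPz r2'' hhead', hzP p3'' hlast', hPz p3'' hhead, hzP r3'' hlast,
        hPz r3'' hhead'⟩
  · have h1 : [P₁, z, R₁, invRev z, P₂, z, R₂, invRev z, P₃, z, R₃, invRev z].flatten =
        P₁ ++ [z, R₁, invRev z, P₂, z, R₂, invRev z, P₃, z, R₃].flatten ++ invRev z := by simp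
    rw [h1, List.getLast?_append_of_ne_nil _ hz', List.append_assoc,
      List.head?_append_of_ne_nil _ p1']
    exact hzP p1'' hlast'

theorem twist_of_eq_mk (i j k : α) :
    twist (of i) (of j) (of k) = mk [(i, true), (k, true), (j, true), (k, false), (i, true),
      (k, true), (i, true), (k, false), (j, true), (k, true), (i, true), (k, false)] := by
  simp [twist, halfTwist, of, inv_mk, invRev, mul_mk]

theorem norm_twist_of_le [DecidableEq α] (i j k : α) :
    norm (twist (of i) (of j) (of k)) ≤ 12 := by
  rw [twist_of_eq_mk]
  exact norm_mk_le

theorem twist_of_not_conj_twist_one [DecidableEq α] {i j k : α} (hik : i ≠ k) (hjk : j ≠ k)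
    (q : FreeGroup α) :
    twist (of i) (of j) (of k) ≠ q * twist (of i) (of j) 1 * q⁻¹ := by
  intro h
  have hmk1 : twist (of i) (of j) 1 =
      mk [(i, true), (j, true), (i, true), (i, true), (j, true), (i, true)] := by
    simp [twist, halfTwist, of, mul_mk]
  have hred : IsCyclicallyReduced [(i, true), (k, true), (j, true), (k, false),
      (i, true), (k, true), (i, true), (k, false), (j, true), (k, true), (i, true), (k, false)] := by
    simp [IsCyclicallyReduced, IsReduced, hik, hjk, hik.symm, hjk.symm]
  rw [twist_of_eq_mk] at h
  have h12 := IsCyclicallyReduced.length_le_norm_of_mk_eq_conj hred h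
  rw [hmk1] at h12
  have h6 := h12.trans norm_mk_le
  simp at h6

/-- If `twist (of i) (of j) x` is conjugate to `twist (of i) (of j) (of k)`, then `x` is a letter. -/
theorem norm_le_one_of_twist_conj [DecidableEq α] {i j k : α} (hij : i ≠ j) (hik : i ≠ k)
    (hjk : j ≠ k) {x q : FreeGroup α}
    (h : twist (of i) (of j) x = q * twist (of i) (of j) (of k) * q⁻¹) : norm x ≤ 1 := by
  let p : α → Prop := fun l => l = i ∨ l = j
  rcases List.exists_maximal_prefix_suffix (fun l : α × Bool => p l.1) x.toWord with
    hx | ⟨g, z, h', hxw, hg, hh, hz0, hhead, hlast⟩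
  · exfalso
    let ρ := FreeGroup.lift fun l => if p l then of l else (1 : FreeGroup α)
    have hρx : ρ x = x := by
      have := lift_ite_eq_self hx
      rwa [mk_toWord] at this
    have hρi : ρ (of i) = of i := by simp [ρ, p]
    have hρj : ρ (of j) = of j := by simp [ρ, p]
    have hρk : ρ (of k) = 1 := by simp [ρ, p, hik.symm, hjk.symm]
    have h1 := congrArg ρ h
    rw [map_twist, _root_.map_mul, _root_.map_mul, map_twist, _root_.map_inv, hρx, hρi, hρj, hρk, h] at h1
    refine twist_of_not_conj_twist_one hik hjk (q⁻¹ * ρ q) ?_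
    calc twist (of i) (of j) (of k)
        = q⁻¹ * (q * twist (of i) (of j) (of k) * q⁻¹) * q := by group
      _ = _ := by rw [h1]; group
  · have hred : IsReduced (g ++ z ++ h') := hxw ▸ isReduced_toWord
    have hgr : IsReduced g := hred.infix ⟨[], z ++ h', by simp⟩
    have hzr : IsReduced z := hred.infix ⟨g, h', rfl⟩
    have hhr : IsReduced h' := hred.infix ⟨g ++ z, [], by simp⟩
    have hx : x = mk g * mk z * mk h' := by rw [mul_mk, mul_mk, ← hxw, mk_toWord]
    have hgw : (mk g).toWord = g := by rw [toWord_mk, hgr.reduce_eq]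
    have hhw : (mk h').toWord = h' := by rw [toWord_mk, hhr.reduce_eq]
    have hP {l : α} (hl : p l) : IsReduced ((mk g)⁻¹ * of l * mk g).toWord ∧
        ((mk g)⁻¹ * of l * mk g).toWord ≠ [] ∧
        ∀ m ∈ ((mk g)⁻¹ * of l * mk g).toWord, p m.1 := by
      refine ⟨isReduced_toWord, fun h0 => of_ne_one l ?_, ?_⟩
      · rw [toWord_eq_nil_iff] at h0
        simpa using (conj_eq_one_iff (a := (mk g)⁻¹) (b := of l)).1 (by simpa using h0)
      · have hg' : ∀ m ∈ (mk g).toWord, p m.1 := by rwa [hgw]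
        exact forall_mem_toWord_mul (forall_mem_toWord_mul (forall_mem_toWord_inv hg')
          (by simpa using hl)) hg'
    have hR {l : α} (hl : p l) : IsReduced (mk h' * of l * (mk h')⁻¹).toWord ∧
        (mk h' * of l * (mk h')⁻¹).toWord ≠ [] ∧
        ∀ m ∈ (mk h' * of l * (mk h')⁻¹).toWord, p m.1 := by
      refine ⟨isReduced_toWord, fun h0 => of_ne_one l ?_, ?_⟩
      · rw [toWord_eq_nil_iff] at h0
        exact conj_eq_one_iff.1 h0
      · have hh' : ∀ m ∈ (mk h').toWord, p m.1 := by rwa [hhw]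
        exact forall_mem_toWord_mul (forall_mem_toWord_mul hh' (by simpa using hl))
          (forall_mem_toWord_inv hh')
    have hpi : p i := Or.inl rfl
    have hpj : p j := Or.inr rfl
    have hcyc := isCyclicallyReduced_flatten_alternating hzr hz0 hhead hlast
      (P₁ := ((mk g)⁻¹ * of i * mk g).toWord) (P₂ := ((mk g)⁻¹ * of i * mk g).toWord)
      (P₃ := ((mk g)⁻¹ * of j * mk g).toWord) (R₁ := (mk h' * of j * (mk h')⁻¹).toWord)
      (R₂ := (mk h' * of i * (mk h')⁻¹).toWord) (R₃ := (mk h' * of i * (mk h')⁻¹).toWord) (by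
        simp only [List.forall_mem_cons, List.not_mem_nil, false_imp_iff, implies_true, and_true]
        exact ⟨hP hpi, hP hpi, hP hpj, hR hpj, hR hpi, hR hpi⟩)
    have hlen := (hcyc.length_le_norm_of_mk_eq_conj (q := (mk g)⁻¹ * q)
      (w := twist (of i) (of j) (of k)) (by
        have h1 : (mk g)⁻¹ * q * twist (of i) (of j) (of k) * ((mk g)⁻¹ * q)⁻¹ =
            (mk g)⁻¹ * twist (of i) (of j) x * mk g := by
          rw [h]
          group
        rw [h1, hx]
        simp only [List.flatten_cons, List.flatten_nil, List.append_nil, ← mul_mk, mk_toWord,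
          ← inv_mk, twist, halfTwist]
        group)).trans (norm_twist_of_le i j k)
    have hPi := List.length_pos_iff.2 (hP hpi).2.1
    have hPj := List.length_pos_iff.2 (hP hpj).2.1
    have hRi := List.length_pos_iff.2 (hR hpi).2.1
    have hRj := List.length_pos_iff.2 (hR hpj).2.1
    have hz1 := List.length_pos_iff.2 hz0
    simp only [List.flatten_cons, List.flatten_nil, List.append_nil, List.length_append,
      invRev_length] at hlen
    have hgnil : g = [] := eq_nil_of_norm_conj_le_one hgr hij
      (by rw [norm]; omega) (by rw [norm]; omega)
    have hhnil : invRev h' = [] := by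
      refine eq_nil_of_norm_conj_le_one hhr.invRev hij ?_ ?_
      · rw [← inv_mk, inv_inv, norm]
        omega
      · rw [← inv_mk, inv_inv, norm]
        omega
    have hhlen : h'.length = 0 := by rw [← invRev_length, hhnil, List.length_nil]
    rw [norm, hxw, hgnil]
    simp only [List.length_append, List.length_nil]
    omega

theorem finite_setOf_norm_le [DecidableEq α] [Finite α] (N : ℕ) :
    {x : FreeGroup α | norm x ≤ N}.Finite :=
  Set.Finite.of_finite_image ((List.finite_length_le (α × Bool) N).subset
    (by rintro _ ⟨x, hx, rfl⟩; exact hx)) toWord_injective.injOn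

/-- The automorphism of a free group inverting the letter `k` and multiplying the letter `l` by
`halfTwist (of i) (of j) (of k)` on the right. -/
def twistAut [DecidableEq α] {i j k l : α} (hik : i ≠ k) (hjk : j ≠ k) (hil : i ≠ l) (hjl : j ≠ l)
    (hkl : k ≠ l) : FreeGroup α ≃* FreeGroup α :=
  MonoidHom.toMulEquiv
    (FreeGroup.lift fun m => if m = k then (of k)⁻¹ else
      if m = l then of l * halfTwist (of i) (of j) (of k) else of m)
    (FreeGroup.lift fun m => if m = k then (of k)⁻¹ else
      if m = l then of l * (halfTwist (of i) (of j) (of k)⁻¹)⁻¹ else of m)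
    (by
      ext m
      by_cases hmk : m = k
      · simp [hmk]
      · by_cases hml : m = l
        · simp [hml, map_halfTwist, hik, hjk, hil, hjl, hkl.symm]
        · simp [hmk, hml])
    (by
      ext m
      by_cases hmk : m = k
      · simp [hmk]
      · by_cases hml : m = l
        · simp [hml, map_halfTwist, hik, hjk, hil, hjl, hkl.symm]
        · simp [hmk, hml])

theorem twistAut_of [DecidableEq α] {i j k l : α} (hik : i ≠ k) (hjk : j ≠ k) (hil : i ≠ l)
    (hjl : j ≠ l) (hkl : k ≠ l) (m : α) :
    twistAut hik hjk hil hjl hkl (of m) = if m = k then (of k)⁻¹ else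
      if m = l then of l * halfTwist (of i) (of j) (of k) else of m :=
  FreeGroup.lift_apply_of

end FreeGroup

/-- For every `n ≥ 4`, a free group `Γ` of rank `n` contains subgroups
`A < H` with `acl(A) = H` and `dcl(A) = A`; in particular it contains a subgroup `A`
whose definable closure is a proper subgroup of its algebraic closure. -/
theorem exists_acl_ne_dcl {Γ : Type*} [Group Γ] (n : ℕ) (hn : 4 ≤ n)
    (hΓ : Nonempty (Γ ≃* FreeGroup (Fin n))) :
    ∃ A H : Subgroup Γ, A < H ∧
      acl (A : Set Γ) = (H : Set Γ) ∧
      dcl (A : Set Γ) = (A : Set Γ) ∧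
      dcl (A : Set Γ) ⊂ acl (A : Set Γ) := by
  obtain ⟨e⟩ := hΓ
  let i : Fin n := ⟨0, by omega⟩
  let j : Fin n := ⟨1, by omega⟩
  let k : Fin n := ⟨2, by omega⟩
  let l : Fin n := ⟨3, by omega⟩
  have hij : i ≠ j := by simp [i, j]
  have hik : i ≠ k := by simp [i, k]
  have hjk : j ≠ k := by simp [j, k]
  have hil : i ≠ l := by simp [i, l]
  have hjl : j ≠ l := by simp [j, l]
  have hkl : k ≠ l := by simp [k, l]
  let a := FreeGroup.of i
  let b := FreeGroup.of j
  let y := FreeGroup.of k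
  let t := FreeGroup.of l
  let f := FreeGroup.twistAut hik hjk hil hjl hkl
  have hfa : f a = a := by simp [f, a, FreeGroup.twistAut_of, hik, hil]
  have hfb : f b = b := by simp [f, b, FreeGroup.twistAut_of, hjk, hjl]
  have hfy : f y = y⁻¹ := by simp [f, y, FreeGroup.twistAut_of]
  have hft : f t = t * halfTwist a b y := by simp [f, a, b, y, t, FreeGroup.twistAut_of, hkl.symm]
  have hfc : f (t * twist a b y * t⁻¹) = t * twist a b y * t⁻¹ := by
    have h := map_twist f.toMonoidHom a b y
    simp only [MulEquiv.toMonoidHom_eq_coe, MonoidHom.coe_coe, hfa, hfb, hfy] at h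
    rw [map_mul, map_mul, map_inv, h, hft, twist, twist, inv_inv]
    group
  let φ : Γ ≃* Γ := (e.trans f).trans e.symm
  have hφ {x : FreeGroup (Fin n)} (hx : f x = x) : φ (e.symm x) = e.symm x := by simp [φ, hx]
  let A : Subgroup Γ := φ.toMonoidHom.eqLocus (MonoidHom.id Γ)
  have hdcl : dcl (A : Set Γ) = A := dcl_fixedPoints φ
  have hyA : e.symm y ∉ A := by
    intro h
    have h1 : φ (e.symm y) = e.symm y := h
    simp only [φ, MulEquiv.trans_apply, MulEquiv.apply_symm_apply, hfy,
      EmbeddingLike.apply_eq_iff_eq] at h1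
    have h2 := congrArg FreeGroup.toWord h1
    simp [y, FreeGroup.toWord_inv, FreeGroup.invRev] at h2
  have hyacl : e.symm y ∈ acl (A : Set Γ) := by
    refine mem_acl_of_finite_twist (A := (A : Set Γ)) (a := e.symm a) (b := e.symm b)
      (c := e.symm (t * twist a b y * t⁻¹)) (hφ hfa) (hφ hfb) (hφ hfc) ?_ (q := e.symm t⁻¹) ?_
    · refine ((FreeGroup.finite_setOf_norm_le 1).preimage e.injective.injOn).subset ?_
      rintro x ⟨q, hq⟩
      have h := congrArg e hq
      have h' := map_twist e.toMonoidHom (e.symm a) (e.symm b) x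
      simp only [MulEquiv.toMonoidHom_eq_coe, MonoidHom.coe_coe, MulEquiv.apply_symm_apply] at h'
      rw [h', map_mul, map_mul, MulEquiv.apply_symm_apply, map_inv] at h
      have hconj : twist a b (e x) = e q * t * twist a b y * (e q * t)⁻¹ := by
        rw [h]
        group
      exact FreeGroup.norm_le_one_of_twist_conj hij hik hjk hconj
    · have h := map_twist e.symm.toMonoidHom a b y
      simp only [MulEquiv.toMonoidHom_eq_coe, MonoidHom.coe_coe] at h
      rw [← h, ← map_inv, ← map_mul, ← map_mul]
      congr 1
      group
  have hsub : (A : Set Γ) ⊆ acl (A : Set Γ) := (subset_dcl _).trans (dcl_subset_acl _)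
  have hlt : (A : Set Γ) ⊂ acl (A : Set Γ) :=
    (Set.ssubset_iff_of_subset hsub).2 ⟨e.symm y, hyacl, hyA⟩
  exact ⟨A, aclSubgroup A, hlt, rfl, hdcl, hdcl.symm ▸ hlt⟩
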